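/- Let G be a CGS, A ⊆ Ξ, n ≥ 0, D a deterministic parity automaton over alphabet S^{n+1}, and 𝔄 the alternating parity automaton over alphabet S^n constructed from G, A and D as described. For all p_1, …, p_n ∈ S^ω: if there exists a set F_A of strategies for the agents in A such that every p ∈ out(G, s°, F_A) satisfies ⊗(p_1, …, p_n, p) ∈ L(D), where s° = p_n(0) if n ≥ 1 and s° = s0 if n = 0, then ⊗(p_1, …, p_n) ∈ L(𝔄). -/

import Mathlib

/-- A concurrent game structure over states `S`, agents `Agent`, moves `M`
and atomic propositions `AP`. -/
structure CGS (S Agent M AP : Type) where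
  s0 : S
  δ : S → (Agent → M) → S
  Lab : S → Set AP

/-- The history `p(0) ⋯ p(i)`. -/
def hist {S : Type} (p : ℕ → S) (i : ℕ) : List S :=
  (List.range (i + 1)).map p

/-- `p ∈ out(G, s, F)`: outcomes from `s` when the agents in `A` follow the
strategies `F`. -/
def InOut {S Agent M : Type} (δ : S → (Agent → M) → S) (A : Set Agent)
    (F : Agent → List S → M) (s : S) (p : ℕ → S) : Prop :=
  p 0 = s ∧ ∀ i, ∃ σ : Agent → M, δ (p i) σ = p (i + 1) ∧
    ∀ ξ ∈ A, σ ξ = F ξ (hist p i)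

/-- Positive boolean formulas over `X`. -/
inductive PosBool (X : Type) where
  | var : X → PosBool X
  | and : PosBool X → PosBool X → PosBool X
  | or : PosBool X → PosBool X → PosBool X

/-- Satisfaction of a positive boolean formula by a set `B ⊆ X`. -/
def PosBool.Sat {X : Type} (B : Set X) : PosBool X → Prop
  | .var x => x ∈ B
  | .and φ ψ => φ.Sat B ∧ ψ.Sat B
  | .or φ ψ => φ.Sat B ∨ ψ.Sat B

/-- Finite disjunction `⋁_{i : ι} f i` as a positive boolean formula. -/
noncomputable def PosBool.bigOr {X ι : Type} [Fintype ι] [Nonempty ι]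
    (f : ι → PosBool X) : PosBool X :=
  ((Finset.univ : Finset ι).toList.map f).foldr PosBool.or (f (Classical.arbitrary ι))

/-- Finite conjunction `⋀_{i : ι} f i` as a positive boolean formula. -/
noncomputable def PosBool.bigAnd {X ι : Type} [Fintype ι] [Nonempty ι]
    (f : ι → PosBool X) : PosBool X :=
  ((Finset.univ : Finset ι).toList.map f).foldr PosBool.and (f (Classical.arbitrary ι))

/-- `cs` satisfies the parity condition: the minimal color occurring
infinitely often in `cs` is even. -/
def ParityAccept (cs : ℕ → ℕ) : Prop :=
  ∃ d, Even d ∧ (∀ N, ∃ k ≥ N, cs k = d) ∧ ∀ d' < d, ∃ N, ∀ k ≥ N, cs k ≠ d'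

/-- An alternating parity automaton over alphabet `Alph` with states `Q`. -/
structure APA (Alph Q : Type) where
  q0 : Q
  ρ : Q → Alph → PosBool Q
  c : Q → ℕ

/-- The node of depth `k` along the infinite branch `b`. -/
def branchPrefix (b : ℕ → ℕ) (k : ℕ) : List ℕ :=
  (List.range k).map b

/-- `(T, r)` is a run of the APA `A` on the word `w`. -/
def APA.IsRun {Alph Q : Type} (A : APA Alph Q) (w : ℕ → Alph)
    (T : Set (List ℕ)) (r : List ℕ → Q) : Prop :=
  ([] ∈ T) ∧
  (∀ τ ∈ T, ∀ τ' : List ℕ, τ' <+: τ → τ' ∈ T) ∧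
  r [] = A.q0 ∧
  ∀ τ ∈ T, PosBool.Sat {q | ∃ m : ℕ, τ ++ [m] ∈ T ∧ r (τ ++ [m]) = q}
    (A.ρ (r τ) (w τ.length))

/-- The run `(T, r)` is accepting: along every infinite branch of `T`, the
minimal color occurring infinitely often is even. -/
def APA.AcceptingRun {Alph Q : Type} (A : APA Alph Q) (w : ℕ → Alph)
    (T : Set (List ℕ)) (r : List ℕ → Q) : Prop :=
  A.IsRun w T r ∧
  ∀ b : ℕ → ℕ, (∀ k, branchPrefix b k ∈ T) →
    ParityAccept (fun k => A.c (r (branchPrefix b k)))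

/-- `w ∈ L(A)` for the APA `A`. -/
def APA.Accepts {Alph Q : Type} (A : APA Alph Q) (w : ℕ → Alph) : Prop :=
  ∃ T r, A.AcceptingRun w T r

/-- A deterministic parity automaton over alphabet `Alph` with states `Q`. -/
structure DPA (Alph Q : Type) where
  q0 : Q
  ρ : Q → Alph → Q
  c : Q → ℕ

/-- The (unique) run of the DPA `D` on the word `w`. -/
def DPA.run {Alph Q : Type} (D : DPA Alph Q) (w : ℕ → Alph) : ℕ → Q
  | 0 => D.q0
  | t + 1 => D.ρ (D.run w t) (w t)

/-- `w ∈ L(D)` for the DPA `D`. -/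
def DPA.Accepts {Alph Q : Type} (D : DPA Alph Q) (w : ℕ → Alph) : Prop :=
  ParityAccept (fun t => D.c (D.run w t))

/-- The combined global move vector `σ + σ'` of a partial move vector `σ` for
the agents in `A` and a partial move vector `σ'` for the agents in `Aᶜ`. -/
def combine {Agent M : Type} [Fintype Agent] [DecidableEq Agent] (A : Finset Agent)
    (σ : {ξ // ξ ∈ A} → M) (σ' : {ξ // ξ ∈ Aᶜ} → M) : Agent → M :=
  fun ξ => if h : ξ ∈ A then σ ⟨ξ, h⟩ else σ' ⟨ξ, Finset.mem_compl.mpr h⟩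

/-- `s° = s_n` (the last component of `v`) if `n ≥ 1`, and `s° = s0` if `n = 0`. -/
def sCirc {S : Type} (s0 : S) {n : ℕ} (v : Fin n → S) : S :=
  if h : 0 < n then v ⟨n - 1, Nat.sub_lt h Nat.one_pos⟩ else s0

/-- The alternating parity automaton over alphabet `Sⁿ` constructed from the
CGS `G`, the agent set `A`, and the deterministic parity automaton `D` over
alphabet `S^{n+1}`: disjunctive choice of moves for the agents in `A`,
conjunctive treatment of the moves of the adversarial agents. -/
noncomputable def constructAPA {S Agent M AP Q : Type}
    [Fintype Agent] [DecidableEq Agent] [Fintype M] [Nonempty M]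
    (G : CGS S Agent M AP) (A : Finset Agent) {n : ℕ}
    (D : DPA (Fin (n + 1) → S) Q) : APA (Fin n → S) ((S × Q) ⊕ Unit) where
  q0 := Sum.inr ()
  ρ := fun q v =>
    match q with
    | Sum.inr _ =>
        PosBool.bigOr (fun σ : {ξ // ξ ∈ A} → M =>
          PosBool.bigAnd (fun σ' : {ξ // ξ ∈ Aᶜ} → M =>
            PosBool.var (Sum.inl
              (G.δ (sCirc G.s0 v) (combine A σ σ'),
               D.ρ D.q0 (Fin.snoc v (sCirc G.s0 v))))))
    | Sum.inl (s, q) =>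
        PosBool.bigOr (fun σ : {ξ // ξ ∈ A} → M =>
          PosBool.bigAnd (fun σ' : {ξ // ξ ∈ Aᶜ} → M =>
            PosBool.var (Sum.inl
              (G.δ s (combine A σ σ'), D.ρ q (Fin.snoc v s)))))
  c := fun q =>
    match q with
    | Sum.inl (_, q) => D.c q
    | Sum.inr _ => 0

theorem PosBool.sat_bigOr {X ι : Type} [Fintype ι] [Nonempty ι] (B : Set X)
    (f : ι → PosBool X) (i : ι) (h : (f i).Sat B) : (PosBool.bigOr f).Sat B := by
  have key : ∀ (l : List ι) (φ : PosBool X), i ∈ l →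
      ((l.map f).foldr PosBool.or φ).Sat B := by
    intro l φ hl
    induction l with
    | nil => simp at hl
    | cons a l ih =>
      rcases List.mem_cons.mp hl with rfl | hl
      · exact Or.inl h
      · exact Or.inr (ih hl)
  exact key _ _ (Finset.mem_toList.mpr (Finset.mem_univ i))

theorem PosBool.sat_bigAnd {X ι : Type} [Fintype ι] [Nonempty ι] (B : Set X)
    (f : ι → PosBool X) (h : ∀ i, (f i).Sat B) : (PosBool.bigAnd f).Sat B := by
  have key : ∀ (l : List ι) (φ : PosBool X), φ.Sat B →
      ((l.map f).foldr PosBool.and φ).Sat B := by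
    intro l φ hφ
    induction l with
    | nil => exact hφ
    | cons a l ih => exact ⟨h a, ih⟩
  exact key _ _ (h _)

theorem ParityAccept.of_succ {cs cs' : ℕ → ℕ} (h : ParityAccept cs)
    (heq : ∀ k, cs' (k + 1) = cs (k + 1)) : ParityAccept cs' := by
  have heq' : ∀ k ≥ 1, cs' k = cs k := by
    rintro (_ | k) hk
    · omega
    · exact heq k
  obtain ⟨d, hd, hinf, hfin⟩ := h
  refine ⟨d, hd, fun N => ?_, fun d' hd' => ?_⟩
  · obtain ⟨k, hk, hc⟩ := hinf (N + 1)
    exact ⟨k, by omega, by rw [heq' k (by omega), hc]⟩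
  · obtain ⟨N, hN⟩ := hfin d' hd'
    exact ⟨N + 1, fun k hk => by rw [heq' k (by omega)]; exact hN k (by omega)⟩

theorem hist_succ {S : Type} (p : ℕ → S) (i : ℕ) :
    hist p (i + 1) = hist p i ++ [p (i + 1)] := by
  simp [hist, List.range_succ]

theorem branchPrefix_succ (b : ℕ → ℕ) (k : ℕ) :
    branchPrefix b (k + 1) = branchPrefix b k ++ [b k] := by
  simp [branchPrefix, List.range_succ]

/-- The situation at a node of the run tree: the play so far, its last state,
and the state reached by the deterministic automaton. -/
structure PlayState (S Q : Type) where
  time : ℕ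
  history : List S
  state : S
  auto : Q

/-- One round of play in which the agents in `A` follow the strategies `F`. -/
def PlayState.step {S Agent M AP Q : Type} [Fintype Agent] [DecidableEq Agent]
    (G : CGS S Agent M AP) (A : Finset Agent) {n : ℕ}
    (D : DPA (Fin (n + 1) → S) Q) (w : ℕ → Fin n → S) (F : Agent → List S → M)
    (c : PlayState S Q) (σ' : {ξ // ξ ∈ Aᶜ} → M) : PlayState S Q :=
  let s := G.δ c.state (combine A (fun ξ => F ξ c.history) σ')
  ⟨c.time + 1, c.history ++ [s], s, D.ρ c.auto (Fin.snoc (w c.time) c.state)⟩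

/-- The situation after the adversarial moves coded by `τ` have been played from `s`. -/
def PlayState.after {S Agent M AP Q : Type} [Fintype Agent] [DecidableEq Agent]
    (G : CGS S Agent M AP) (A : Finset Agent) {n : ℕ}
    (D : DPA (Fin (n + 1) → S) Q) (w : ℕ → Fin n → S) (F : Agent → List S → M)
    (e : ℕ → {ξ // ξ ∈ Aᶜ} → M) (s : S) (τ : List ℕ) : PlayState S Q :=
  τ.foldl (fun c m => PlayState.step G A D w F c (e m)) ⟨0, [s], s, D.q0⟩

section PlayState

variable {S Agent M AP Q : Type} [Fintype Agent] [DecidableEq Agent]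
  (G : CGS S Agent M AP) (A : Finset Agent) {n : ℕ}
  (D : DPA (Fin (n + 1) → S) Q) (w : ℕ → Fin n → S) (F : Agent → List S → M)
  (e : ℕ → {ξ // ξ ∈ Aᶜ} → M) (s : S)

theorem PlayState.after_append_singleton (τ : List ℕ) (m : ℕ) :
    PlayState.after G A D w F e s (τ ++ [m]) =
      PlayState.step G A D w F (PlayState.after G A D w F e s τ) (e m) := by
  simp [PlayState.after]

theorem PlayState.time_after (τ : List ℕ) :
    (PlayState.after G A D w F e s τ).time = τ.length := by
  induction τ using List.reverseRecOn with
  | nil => rfl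
  | append_singleton τ m ih => simp [after_append_singleton, step, ih]

theorem PlayState.history_after_branchPrefix (b : ℕ → ℕ) (k : ℕ) :
    (PlayState.after G A D w F e s (branchPrefix b k)).history =
      hist (fun i => (PlayState.after G A D w F e s (branchPrefix b i)).state) k := by
  induction k with
  | zero => rfl
  | succ k ih =>
    rw [hist_succ, ← ih, branchPrefix_succ, after_append_singleton]
    rfl

theorem PlayState.inOut_state_after (b : ℕ → ℕ) :
    InOut G.δ (↑A) F s
      (fun i => (PlayState.after G A D w F e s (branchPrefix b i)).state) := by
  refine ⟨rfl, fun i => ⟨combine A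
    (fun ξ => F ξ (PlayState.after G A D w F e s (branchPrefix b i)).history) (e (b i)), ?_, ?_⟩⟩
  · simp only [branchPrefix_succ, after_append_singleton, step]
  · intro ξ hξ
    rw [← history_after_branchPrefix]
    simp [combine, Finset.mem_coe.mp hξ]

theorem PlayState.auto_after_branchPrefix (b : ℕ → ℕ) (k : ℕ) :
    (PlayState.after G A D w F e s (branchPrefix b k)).auto =
      D.run (fun t => Fin.snoc (w t)
        (PlayState.after G A D w F e s (branchPrefix b t)).state) k := by
  induction k with
  | zero => rfl
  | succ k ih =>
    rw [DPA.run, ← ih, branchPrefix_succ, after_append_singleton]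
    simp [step, time_after, branchPrefix]

end PlayState

/-- If the agents in `A` have strategies such that every outcome `p` from `s°`
satisfies `⊗(p_1, …, p_n, p) ∈ L(D)`, then the constructed APA accepts the
zipping `⊗(p_1, …, p_n)`. -/
theorem strategy_implies_apa_accepts {S Agent M AP Q : Type}
    [Fintype S] [Fintype Agent] [Nonempty Agent] [DecidableEq Agent]
    [Fintype M] [Nonempty M] [Fintype AP] [Fintype Q]
    (G : CGS S Agent M AP) (A : Finset Agent) (n : ℕ)
    (D : DPA (Fin (n + 1) → S) Q)
    (ps : Fin n → ℕ → S)
    (hstrat : ∃ F : Agent → List S → M,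
      ∀ p : ℕ → S, InOut G.δ (↑A) F (sCirc G.s0 (fun j => ps j 0)) p →
        D.Accepts (fun t => Fin.snoc (fun j => ps j t) (p t))) :
    (constructAPA G A D).Accepts (fun t j => ps j t) := by
  obtain ⟨F, hF⟩ := hstrat
  obtain ⟨e, he⟩ := exists_surjective_nat ({ξ // ξ ∈ Aᶜ} → M)
  let w : ℕ → Fin n → S := fun t j => ps j t
  let cfg := PlayState.after G A D w F e (sCirc G.s0 (w 0))
  let r : List ℕ → (S × Q) ⊕ Unit := fun τ =>
    if τ = [] then Sum.inr () else Sum.inl ((cfg τ).state, (cfg τ).auto)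
  have hchild : ∀ τ m, r (τ ++ [m]) = Sum.inl
      (G.δ (cfg τ).state (combine A (fun ξ => F ξ (cfg τ).history) (e m)),
        D.ρ (cfg τ).auto (Fin.snoc (w τ.length) (cfg τ).state)) := by
    intro τ m
    simp [r, cfg, PlayState.after_append_singleton, PlayState.step, PlayState.time_after]
  refine ⟨Set.univ, r, ⟨trivial, fun _ _ _ _ => trivial, rfl, fun τ _ => ?_⟩, fun b _ => ?_⟩
  · by_cases hτ : τ = []
    · subst hτ
      rw [show r [] = Sum.inr () from rfl]
      simp only [constructAPA]
      refine PosBool.sat_bigOr _ _ (fun ξ => F ξ (cfg []).history) ?_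
      refine PosBool.sat_bigAnd _ _ fun σ' => ?_
      obtain ⟨m, rfl⟩ := he σ'
      exact ⟨m, trivial, hchild [] m⟩
    · have hr : r τ = Sum.inl ((cfg τ).state, (cfg τ).auto) := if_neg hτ
      rw [hr]
      simp only [constructAPA]
      refine PosBool.sat_bigOr _ _ (fun ξ => F ξ (cfg τ).history) ?_
      refine PosBool.sat_bigAnd _ _ fun σ' => ?_
      obtain ⟨m, rfl⟩ := he σ'
      exact ⟨m, trivial, hchild τ m⟩
  · refine ParityAccept.of_succ
      (hF _ (PlayState.inOut_state_after G A D w F e (sCirc G.s0 (w 0)) b)) fun k => ?_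
    have hne : branchPrefix b (k + 1) ≠ [] := by simp [branchPrefix_succ]
    have hr : r (branchPrefix b (k + 1)) = Sum.inl ((cfg (branchPrefix b (k + 1))).state,
      (cfg (branchPrefix b (k + 1))).auto) := if_neg hne
    simp only [hr]
    exact congrArg D.c (PlayState.auto_after_branchPrefix G A D w F e (sCirc G.s0 (w 0)) b (k + 1))
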